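/- Let p > 0 and let ω, ~ρ be probability measures on ℝ such that the subordination distribution ω ⊳ ~ρ is ⊞-infinitely divisible. Then for every t ≥ 0, the function φ_{~ρ} + (t/p)·φ_ω is the Voiculescu transform of a probability measure, namely of ~ρ ▷ (ω ⊳ ~ρ)^{⊞(t/p)}; in particular ~ρ ⊞ ω^{⊞(t/p)} := ~ρ ▷ (ω ⊳ ~ρ)^{⊞(t/p)} is a well-defined probability measure for all t ≥ 0. -/

import Mathlib

open MeasureTheory Complex

noncomputable section

/-- The Cauchy transform `G_μ(z) = ∫ 1/(z - x) dμ(x)` of a measure on `ℝ`. -/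
def cauchyG (μ : Measure ℝ) (z : ℂ) : ℂ := ∫ x : ℝ, (z - (x : ℂ))⁻¹ ∂μ

/-- The F-transform `F_μ = 1/G_μ`. -/
def Ftr (μ : Measure ℝ) (z : ℂ) : ℂ := (cauchyG μ z)⁻¹

/-- The open upper half-plane `ℂ⁺`. -/
def UHP : Set ℂ := {z : ℂ | 0 < z.im}

/-- The truncated cone `Γ_{α,M} = {z ∈ ℂ⁺ : |Re z| < α · Im z, Im z > M}`. -/
def tcone (α M : ℝ) : Set ℂ := {z : ℂ | |z.re| < α * z.im ∧ M < z.im}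

/-- `φ` is a Voiculescu transform of `μ`: `φ(F_μ(z)) + F_μ(z) = z` on some truncated cone. -/
def IsVT (μ : Measure ℝ) (φ : ℂ → ℂ) : Prop :=
  ∃ α M : ℝ, 0 < α ∧ 0 < M ∧ ∀ z ∈ tcone α M, φ (Ftr μ z) + Ftr μ z = z

/-- `ψ` is a two-state Voiculescu transform of the pair `(μt, μ)`:
`ψ(F_μ(z)) + F_{μt}(z) = z` on some truncated cone. -/
def IsTwoStateVT (μt μ : Measure ℝ) (ψ : ℂ → ℂ) : Prop :=
  ∃ α M : ℝ, 0 < α ∧ 0 < M ∧ ∀ z ∈ tcone α M, ψ (Ftr μ z) + Ftr μt z = z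

/-- `μ` is freely infinitely divisible: some Voiculescu transform `φ` of `μ` is such that
`t·φ` is a Voiculescu transform of a probability measure for every `t ≥ 0`. -/
def IsFID (μ : Measure ℝ) : Prop :=
  ∃ φ : ℂ → ℂ, IsVT μ φ ∧ ∀ t : ℝ, 0 ≤ t →
    ∃ ν : Measure ℝ, IsProbabilityMeasure ν ∧ IsVT ν (fun z => (t : ℂ) * φ z)

/-- The semicircular distribution with mean `β` and variance `γ` (Dirac mass at `β` for `γ = 0`). -/
def semicircle (β γ : ℝ) : Measure ℝ :=
  if γ = 0 then Measure.dirac β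
  else volume.withDensity
    (fun x => ENNReal.ofReal ((2 * Real.pi * γ)⁻¹ * Real.sqrt (4 * γ - (x - β) ^ 2)))

section

open Filter Topology Metric

/-! ### Basic properties of the Cauchy transform -/

lemma mem_UHP {z : ℂ} : z ∈ UHP ↔ 0 < z.im := Iff.rfl

lemma isOpen_UHP : IsOpen UHP := isOpen_lt continuous_const Complex.continuous_im

lemma convex_UHP : Convex ℝ UHP := convex_halfSpace_im_gt 0

lemma im_le_norm_sub_ofReal (z : ℂ) (x : ℝ) : z.im ≤ ‖z - x‖ := by
  simpa using (le_abs_self _).trans (Complex.abs_im_le_norm (z - x))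

lemma sub_ofReal_ne_zero {z : ℂ} (hz : z ∈ UHP) (x : ℝ) : z - x ≠ 0 :=
  norm_pos_iff.1 ((mem_UHP.1 hz).trans_le (im_le_norm_sub_ofReal z x))

lemma norm_inv_sub_ofReal_le {z : ℂ} (hz : z ∈ UHP) (x : ℝ) : ‖(z - x)⁻¹‖ ≤ z.im⁻¹ := by
  rw [norm_inv]
  exact inv_anti₀ hz (im_le_norm_sub_ofReal z x)

lemma continuous_inv_sub_ofReal {z : ℂ} (hz : z ∈ UHP) :
    Continuous fun x : ℝ => (z - (x : ℂ))⁻¹ :=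
  Continuous.inv₀ (by fun_prop) (sub_ofReal_ne_zero hz)

lemma integrable_inv_sub_ofReal (μ : Measure ℝ) [IsFiniteMeasure μ] {z : ℂ} (hz : z ∈ UHP) :
    Integrable (fun x : ℝ => (z - (x : ℂ))⁻¹) μ :=
  .of_bound (continuous_inv_sub_ofReal hz).aestronglyMeasurable _
    (.of_forall (norm_inv_sub_ofReal_le hz))

lemma differentiableOn_cauchyG (μ : Measure ℝ) [IsFiniteMeasure μ] :
    DifferentiableOn ℂ (cauchyG μ) UHP := by
  have h : cauchyG μ = fun z => -resolventTransform μ z := by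
    ext z
    simp [cauchyG, resolventTransform, resolvent, ← integral_neg, ← inv_neg]
  rw [h]
  intro z hz
  have hz' : z ∉ algebraMap ℝ ℂ '' μ.support := by
    rintro ⟨x, -, rfl⟩
    simp [UHP] at hz
  exact (hasDerivAt_resolventTransform z hz').differentiableAt.neg.differentiableWithinAt

lemma cauchyG_im_neg (μ : Measure ℝ) [IsProbabilityMeasure μ] {z : ℂ} (hz : z ∈ UHP) :
    (cauchyG μ z).im < 0 := by
  have hint := integrable_inv_sub_ofReal μ hz
  have him : ∀ x : ℝ, ((z - (x : ℂ))⁻¹).im < 0 := fun x => by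
    rw [Complex.inv_im]
    have := Complex.normSq_pos.2 (sub_ofReal_ne_zero hz x)
    exact div_neg_of_neg_of_pos (by simpa [UHP] using hz) this
  have h1 : (cauchyG μ z).im = ∫ x : ℝ, ((z - (x : ℂ))⁻¹).im ∂μ :=
    (integral_im (𝕜 := ℂ) hint).symm
  rw [h1, ← neg_pos, ← integral_neg, integral_pos_iff_support_of_nonneg
    (fun x => (neg_pos.2 (him x)).le) hint.im.neg]
  have : Function.support (fun x : ℝ => -((z - (x : ℂ))⁻¹).im) = Set.univ :=
    Set.eq_univ_of_forall fun x => (neg_pos.2 (him x)).ne'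
  rw [this]
  simp

lemma cauchyG_ne_zero (μ : Measure ℝ) [IsProbabilityMeasure μ] {z : ℂ} (hz : z ∈ UHP) :
    cauchyG μ z ≠ 0 := fun h => by simpa [h] using cauchyG_im_neg μ hz

lemma inv_mem_UHP {w : ℂ} (hw : w.im < 0) : w⁻¹ ∈ UHP := by
  have h0 : w ≠ 0 := by rintro rfl; simp at hw
  rw [mem_UHP, Complex.inv_im]
  exact div_pos (neg_pos.2 hw) (Complex.normSq_pos.2 h0)

lemma Ftr_mem_UHP (μ : Measure ℝ) [IsProbabilityMeasure μ] {z : ℂ} (hz : z ∈ UHP) :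
    Ftr μ z ∈ UHP := inv_mem_UHP (cauchyG_im_neg μ hz)

lemma differentiableOn_Ftr (μ : Measure ℝ) [IsProbabilityMeasure μ] :
    DifferentiableOn ℂ (Ftr μ) UHP :=
  (differentiableOn_cauchyG μ).inv fun _ hz => cauchyG_ne_zero μ hz

/-! ### Nontangential behaviour at infinity -/

/-- The filter of neighbourhoods of infinity inside the cone `|Re z| < α · Im z`. -/
def coneFilter (α : ℝ) : Filter ℂ := comap Complex.im atTop ⊓ 𝓟 {z : ℂ | |z.re| < α * z.im}

lemma eventually_coneFilter {α : ℝ} {P : ℂ → Prop} :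
    (∀ᶠ z in coneFilter α, P z) ↔ ∃ M : ℝ, 0 < M ∧ ∀ z ∈ tcone α M, P z := by
  have hb : (comap Complex.im atTop).HasBasis (fun M : ℝ => 0 < M) fun M => Complex.im ⁻¹' Set.Ioi M :=
    (atTop_basis_Ioi' 0).comap _
  rw [coneFilter, (hb.inf_principal _).eventually_iff]
  refine exists_congr fun M => and_congr_right fun _ => forall_congr' fun z => ?_
  simp [tcone, and_comm]

lemma isVT_iff {μ : Measure ℝ} {φ : ℂ → ℂ} :
    IsVT μ φ ↔ ∃ α : ℝ, 0 < α ∧ ∀ᶠ z in coneFilter α, φ (Ftr μ z) + Ftr μ z = z := by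
  simp only [IsVT, eventually_coneFilter, exists_and_left]

lemma coneFilter_mono {α β : ℝ} (h : α ≤ β) : coneFilter α ≤ coneFilter β := by
  intro s hs
  obtain ⟨M, hM, H⟩ := eventually_coneFilter.1 hs
  refine eventually_coneFilter.2 ⟨M, hM, fun z hz => H z ⟨hz.1.trans_le ?_, hz.2⟩⟩
  exact mul_le_mul_of_nonneg_right h (hM.trans hz.2).le

instance (α : ℝ) : (coneFilter α).IsCountablyGenerated := by
  unfold coneFilter; infer_instance

lemma tendsto_im_coneFilter (α : ℝ) : Tendsto Complex.im (coneFilter α) atTop :=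
  tendsto_comap.mono_left inf_le_left

lemma eventually_lt_im_coneFilter (α M : ℝ) : ∀ᶠ z in coneFilter α, M < z.im :=
  (tendsto_im_coneFilter α).eventually_gt_atTop M

lemma eventually_abs_re_lt_coneFilter (α : ℝ) : ∀ᶠ z in coneFilter α, |z.re| < α * z.im :=
  mem_inf_of_right (mem_principal_self _)

lemma eventually_norm_le_coneFilter (α : ℝ) : ∀ᶠ z in coneFilter α, ‖z‖ ≤ (1 + α) * z.im := by
  filter_upwards [eventually_lt_im_coneFilter α 0, eventually_abs_re_lt_coneFilter α] with z h1 h2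
  have := Complex.norm_le_abs_re_add_abs_im z
  rw [abs_of_pos h1] at this
  linarith

/-- `h z - z` is negligible with respect to `Im z` at infinity in every cone. -/
def AsympId (h : ℂ → ℂ) : Prop :=
  ∀ α ε : ℝ, 0 < α → 0 < ε → ∀ᶠ z in coneFilter α, ‖h z - z‖ ≤ ε * z.im

lemma tendsto_mul_cauchyG (μ : Measure ℝ) [IsProbabilityMeasure μ] (α : ℝ) :
    Tendsto (fun z => z * cauchyG μ z) (coneFilter α) (𝓝 1) := by
  have h1 : (1 : ℂ) = ∫ _x : ℝ, (1 : ℂ) ∂μ := by simp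
  have h2 : (fun z => z * cauchyG μ z) = fun z => ∫ x : ℝ, z * (z - (x : ℂ))⁻¹ ∂μ := by
    ext z; rw [cauchyG, integral_const_mul]
  rw [h1, h2]
  refine tendsto_integral_filter_of_dominated_convergence (fun _ => 1 + α) ?_ ?_
    (integrable_const _) (.of_forall fun x => ?_)
  · filter_upwards [eventually_lt_im_coneFilter α 0] with z hz
    exact ((continuous_inv_sub_ofReal hz).const_mul z).aestronglyMeasurable
  · filter_upwards [eventually_lt_im_coneFilter α 0, eventually_norm_le_coneFilter α] with z hz h
    refine .of_forall fun x => ?_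
    rw [norm_mul]
    calc ‖z‖ * ‖(z - (x : ℂ))⁻¹‖ ≤ ((1 + α) * z.im) * z.im⁻¹ :=
          mul_le_mul h (norm_inv_sub_ofReal_le hz x) (norm_nonneg _) ((norm_nonneg _).trans h)
      _ = 1 + α := by have := hz.ne'; field_simp
  · rw [tendsto_iff_norm_sub_tendsto_zero]
    have h3 : Tendsto (fun z : ℂ => |x| * z.im⁻¹) (coneFilter α) (𝓝 0) := by
      simpa using (tendsto_inv_atTop_zero.comp (tendsto_im_coneFilter α)).const_mul |x|
    refine squeeze_zero' (.of_forall fun _ => norm_nonneg _) ?_ h3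
    filter_upwards [eventually_lt_im_coneFilter α 0] with z hz
    have : z * (z - (x : ℂ))⁻¹ - 1 = x * (z - (x : ℂ))⁻¹ := by
      have := sub_ofReal_ne_zero hz x
      field_simp
      ring
    rw [this, norm_mul, Complex.norm_real, Real.norm_eq_abs]
    exact mul_le_mul_of_nonneg_left (norm_inv_sub_ofReal_le hz x) (abs_nonneg x)

lemma asympId_Ftr (μ : Measure ℝ) [IsProbabilityMeasure μ] : AsympId (Ftr μ) := by
  intro α ε hα hε
  have h := (tendsto_mul_cauchyG μ α).inv₀ one_ne_zero
  rw [inv_one] at h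
  have h' := (tendsto_iff_norm_sub_tendsto_zero.1 h).eventually_lt_const
    (show 0 < ε / (1 + α) by positivity)
  filter_upwards [h', eventually_lt_im_coneFilter α 0, eventually_norm_le_coneFilter α]
    with z h1 hz h2
  have hz0 : z ≠ 0 := by rintro rfl; simp at hz
  have : Ftr μ z - z = ((z * cauchyG μ z)⁻¹ - 1) * z := by
    rw [Ftr, mul_inv, sub_mul, one_mul, mul_right_comm, inv_mul_cancel₀ hz0, one_mul]
  rw [this, norm_mul]
  calc _ ≤ (ε / (1 + α)) * ((1 + α) * z.im) :=
        mul_le_mul h1.le h2 (norm_nonneg _) (by positivity)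
    _ = ε * z.im := by field_simp

lemma AsympId.tendsto {h : ℂ → ℂ} (hh : AsympId h) {α β : ℝ} (hα : 0 < α) (hαβ : α < β) :
    Tendsto h (coneFilter α) (coneFilter β) := by
  obtain ⟨ε, hε, hε1, hε2⟩ : ∃ ε : ℝ, 0 < ε ∧ ε ≤ 1 / 2 ∧ α + ε ≤ β * (1 - ε) := by
    have hβ : 0 < β := hα.trans hαβ
    refine ⟨min (1 / 2) ((β - α) / (1 + β)), by have := sub_pos.2 hαβ; positivity, min_le_left _ _,
      ?_⟩
    have := min_le_right (1 / 2) ((β - α) / (1 + β))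
    rw [le_div_iff₀ (by positivity)] at this
    linarith
  have key : ∀ᶠ z in coneFilter α, (1 - ε) * z.im ≤ (h z).im ∧ |(h z).re| < β * (h z).im := by
    filter_upwards [hh α ε hα hε, eventually_lt_im_coneFilter α 0,
      eventually_abs_re_lt_coneFilter α] with z h1 hz h2
    have hre := (Complex.abs_re_le_norm (h z - z)).trans h1
    have him := (abs_le.1 ((Complex.abs_im_le_norm (h z - z)).trans h1)).1
    rw [Complex.sub_re] at hre
    rw [Complex.sub_im] at him
    have h3 : (1 - ε) * z.im ≤ (h z).im := by linarith
    refine ⟨h3, ?_⟩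
    have h4 : |(h z).re| ≤ |z.re| + |(h z).re - z.re| := by
      simpa using abs_add_le z.re ((h z).re - z.re)
    have h5 := mul_le_mul_of_nonneg_right hε2 hz.le
    have h6 := mul_le_mul_of_nonneg_left h3 (hα.trans hαβ).le
    nlinarith
  refine tendsto_inf.2 ⟨tendsto_comap_iff.2 ?_, tendsto_principal.2 (key.mono fun _ h => h.2)⟩
  refine tendsto_atTop_mono' _ (key.mono fun _ h => h.1) ?_
  exact (tendsto_im_coneFilter α).const_mul_atTop (by linarith)

/-- A holomorphic function that is asymptotic to the identity covers, far away in a cone, all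
values from any neighbourhood of infinity of a wider cone. -/
lemma AsympId.eventually_exists_eq {h : ℂ → ℂ} (hh : AsympId h) (hd : DifferentiableOn ℂ h UHP)
    {α β : ℝ} (hα : 0 < α) (hαβ : α < β) {P : ℂ → Prop} (hP : ∀ᶠ z in coneFilter β, P z) :
    ∀ᶠ w in coneFilter α, ∃ z, P z ∧ h z = w := by
  have hβ : 0 < β := hα.trans hαβ
  obtain ⟨c, hc, hc1, hc2⟩ : ∃ c : ℝ, 0 < c ∧ c ≤ 1 / 2 ∧ α + c ≤ β * (1 - c) := by
    refine ⟨min (1 / 2) ((β - α) / (1 + β)), by have := sub_pos.2 hαβ; positivity, min_le_left _ _,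
      ?_⟩
    have := min_le_right (1 / 2) ((β - α) / (1 + β))
    rw [le_div_iff₀ (by positivity)] at this
    linarith
  obtain ⟨M, hM, H⟩ := eventually_coneFilter.1 (hP.and (hh β (c / 16) hβ (by positivity)))
  filter_upwards [eventually_lt_im_coneFilter α (2 * M), eventually_abs_re_lt_coneFilter α]
    with w hw1 hw2
  have hw : 0 < w.im := by linarith
  set r := c * w.im with hr
  have hr0 : 0 < r := by positivity
  have hball : ∀ z ∈ closedBall w r, z ∈ tcone β M ∧ z.im ≤ 2 * w.im := by
    intro z hz
    rw [mem_closedBall, dist_eq_norm] at hz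
    have hre := (Complex.abs_re_le_norm (z - w)).trans hz
    have him := abs_le.1 ((Complex.abs_im_le_norm (z - w)).trans hz)
    rw [Complex.sub_re] at hre
    rw [Complex.sub_im] at him
    have h3 : (1 - c) * w.im ≤ z.im := by linarith
    have h4 : |z.re| ≤ |w.re| + |z.re - w.re| := by
      simpa using abs_add_le w.re (z.re - w.re)
    have h5 := mul_le_mul_of_nonneg_right hc2 hw.le
    have h6 := mul_le_mul_of_nonneg_left h3 hβ.le
    refine ⟨⟨by nlinarith, by nlinarith⟩, by nlinarith⟩
  have hdist : ∀ z ∈ closedBall w r, ‖h z - z‖ ≤ r / 8 := by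
    intro z hz
    obtain ⟨h1, h2⟩ := hball z hz
    have := (H z h1).2
    rw [hr]
    nlinarith
  have hsub : closedBall w r ⊆ UHP := fun z hz => hM.trans (hball z hz).1.2
  have hww : w ∈ closedBall w r := mem_closedBall_self hr0.le
  have hsphere : ∀ z ∈ sphere w r, r / 2 ≤ ‖h z - h w‖ := by
    intro z hz
    have h1 := hdist z (sphere_subset_closedBall hz)
    have h2 := hdist w hww
    rw [mem_sphere, dist_eq_norm] at hz
    have : z - w = (h z - h w) - (h z - z) + (h w - w) := by ring
    have h3 := (norm_add_le ((h z - h w) - (h z - z)) (h w - w)).trans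
      (add_le_add_left (norm_sub_le _ _) _)
    rw [← this] at h3
    linarith
  have hfreq : ∃ᶠ z in 𝓝 w, h z ≠ h w := by
    intro hcon
    simp only [ne_eq, not_not] at hcon
    have h1 := (hd.analyticOnNhd isOpen_UHP).eqOn_of_preconnected_of_eventuallyEq
      (analyticOnNhd_const (v := h w)) convex_UHP.isPreconnected (hsub hww) hcon
    have hz : w + r ∈ sphere w r := by simp [abs_of_pos hr0]
    have h2 := hsphere _ hz
    rw [h1 (hsub (sphere_subset_closedBall hz)), sub_self, norm_zero] at h2
    linarith
  have hdc : DiffContOnCl ℂ h (ball w r) :=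
    (hd.mono (by rwa [closure_ball w hr0.ne'])).diffContOnCl
  obtain ⟨z, hz, hzw⟩ := hdc.ball_subset_image_closedBall hr0 hsphere hfreq
    (show w ∈ ball (h w) (r / 2 / 2) by
      rw [mem_ball, dist_comm, dist_eq_norm]
      have := hdist w hww
      linarith)
  exact ⟨z, (H z (hball z hz).1).1, hzw⟩

/-! ### Existence of the monotone convolution -/

lemma exists_cauchyG_eq_sum {ι : Type*} [Fintype ι] (w : ι → ℝ) (hw : ∀ i, 0 ≤ w i)
    (hw1 : ∑ i, w i = 1) (k : ι → Measure ℝ) (hk : ∀ i, IsProbabilityMeasure (k i)) :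
    ∃ m : Measure ℝ, IsProbabilityMeasure m ∧
      ∀ z ∈ UHP, cauchyG m z = ∑ i, (w i : ℂ) * cauchyG (k i) z := by
  refine ⟨∑ i, ENNReal.ofReal (w i) • k i, ⟨?_⟩, fun z hz => ?_⟩
  · simp [← ENNReal.ofReal_sum_of_nonneg fun i _ => hw i, hw1]
  · rw [cauchyG, integral_finsetSum_measure fun i _ =>
      (integrable_inv_sub_ofReal (k i) hz).smul_measure ENNReal.ofReal_ne_top]
    refine Finset.sum_congr rfl fun i _ => ?_
    rw [integral_smul_measure, ENNReal.toReal_ofReal (hw i), Complex.real_smul, cauchyG]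

lemma cauchyG_dirac (x : ℝ) (z : ℂ) : cauchyG (.dirac x) z = (z - x)⁻¹ := by
  simp [cauchyG]

/-- The spectral measure of a symmetric operator at a unit vector. -/
lemma LinearMap.IsSymmetric.exists_cauchyG_eq_inner {E : Type*} [NormedAddCommGroup E]
    [InnerProductSpace ℂ E] [FiniteDimensional ℂ E] {T : E →ₗ[ℂ] E} (hT : T.IsSymmetric)
    {v : E} (hv : ‖v‖ = 1) :
    ∃ k : Measure ℝ, IsProbabilityMeasure k ∧
      ∀ z ∈ UHP, ∀ u : E, z • u - T u = v → cauchyG k z = inner ℂ v u := by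
  set e := hT.eigenvectorBasis rfl
  set l := hT.eigenvalues rfl
  obtain ⟨k, hk, h⟩ := exists_cauchyG_eq_sum (fun i => ‖inner ℂ (e i) v‖ ^ 2)
    (fun i => by positivity) (by rw [e.sum_sq_norm_inner_right, hv, one_pow])
    (fun i => .dirac (l i)) (fun i => inferInstance)
  refine ⟨k, hk, fun z hz u hu => ?_⟩
  rw [h z hz, ← e.sum_inner_mul_inner v u]
  refine Finset.sum_congr rfl fun i _ => ?_
  have h1 : inner ℂ (e i) v = (z - l i) * inner ℂ (e i) u := by
    rw [← hu, inner_sub_right, inner_smul_right, ← hT (e i) u, hT.apply_eigenvectorBasis,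
      inner_smul_left]
    simp [e, l, sub_mul]
  have h2 := sub_ofReal_ne_zero hz (l i)
  have h3 : inner ℂ (e i) u = (z - l i)⁻¹ * inner ℂ (e i) v := by
    rw [h1, inv_mul_cancel_left₀ h2]
  rw [cauchyG_dirac, h3, ← inner_conj_symm v (e i), Complex.ofReal_pow, ← Complex.conj_mul',
    mul_left_comm, mul_comm]

/-- Rank-one perturbation of a diagonal operator. -/
lemma exists_cauchyG_eq_inv_sub {ι : Type*} [Fintype ι] (p a : ι → ℝ) (hp : ∀ i, 0 ≤ p i)
    (hp1 : ∑ i, p i = 1) (b : ℝ) :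
    ∃ k : Measure ℝ, IsProbabilityMeasure k ∧
      ∀ z ∈ UHP, cauchyG k z = ((∑ i, (p i : ℂ) * (z - a i)⁻¹)⁻¹ - b)⁻¹ := by
  classical
  let v : ι → ℂ := fun i => (√(p i) : ℂ)
  have hvv : ∀ i, v i * v i = p i := fun i => by
    rw [← Complex.ofReal_mul, Real.mul_self_sqrt (hp i)]
  have hsv : star v = v := by ext i; simp [v]
  let A : Matrix ι ι ℂ := Matrix.diagonal (fun i => (a i : ℂ)) + (b : ℂ) • Matrix.vecMulVec v v
  have hA : A.IsHermitian := by
    ext i j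
    simp [A, Matrix.vecMulVec_apply, Matrix.diagonal_apply, v, mul_comm, eq_comm]
    split_ifs with h <;> simp [h]
  have hv : ‖(WithLp.toLp 2 v : EuclideanSpace ℂ ι)‖ = 1 := by
    rw [EuclideanSpace.norm_eq, Real.sqrt_eq_one, ← hp1]
    exact Finset.sum_congr rfl fun i _ => by
      simp [v, Real.sq_sqrt (hp i)]
  obtain ⟨k, hk, h⟩ := LinearMap.IsSymmetric.exists_cauchyG_eq_inner
    (Matrix.isSymmetric_toEuclideanLin_iff.2 hA) hv
  refine ⟨k, hk, fun z hz => ?_⟩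
  set G : ℂ := ∑ i, (p i : ℂ) * (z - a i)⁻¹ with hG
  obtain ⟨m, hm, hmG⟩ := exists_cauchyG_eq_sum p hp hp1 (fun i => .dirac (a i))
    (fun i => inferInstance)
  have hGm : cauchyG m z = G := by simp [hmG z hz, cauchyG_dirac, hG]
  have hG0 : G ≠ 0 := hGm ▸ cauchyG_ne_zero m hz
  have hF : G⁻¹ - b ≠ 0 := sub_ofReal_ne_zero (hGm ▸ Ftr_mem_UHP m hz) b
  have hF' : 1 - b * G ≠ 0 := by
    intro h0
    apply hF
    field_simp
    linear_combination h0
  set c : ℂ := (1 - b * G)⁻¹ with hc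
  have hsum : ∑ i, v i * (c * v i * (z - a i)⁻¹) = c * G := by
    rw [hG, Finset.mul_sum]
    exact Finset.sum_congr rfl fun i _ => by rw [← hvv]; ring
  rw [h z hz (WithLp.toLp 2 fun i => c * v i * (z - a i)⁻¹)]
  · rw [EuclideanSpace.inner_eq_star_dotProduct, hsv, dotProduct_comm, dotProduct]
    simp only []
    rw [hsum, hc]
    field_simp
  · ext i
    have hz' := sub_ofReal_ne_zero hz (a i)
    simp only [A, Matrix.toLpLin_apply, PiLp.sub_apply, PiLp.smul_apply, Matrix.add_mulVec,
      Matrix.smul_mulVec, Matrix.vecMulVec_mulVec, Matrix.mulVec_diagonal, Pi.add_apply,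
      Pi.smul_apply, smul_eq_mul, dotProduct, hsum, MulOpposite.smul_eq_mul_unop,
      MulOpposite.unop_op]
    have : c * (1 - b * G) = 1 := inv_mul_cancel₀ hF'
    field_simp
    linear_combination v i * (z - a i) * this

lemma integral_comp_simpleFunc (μ : Measure ℝ) [IsFiniteMeasure μ] (f : SimpleFunc ℝ ℝ)
    (g : ℝ → ℂ) :
    ∫ x, g (f x) ∂μ = ∑ a : f.range, (μ.real (f ⁻¹' {a.1}) : ℂ) * g a := by
  rw [Finset.sum_coe_sort f.range (fun a => (μ.real (f ⁻¹' {a}) : ℂ) * g a)]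
  have h : (fun x => g (f x)) = fun x => ∑ a ∈ f.range, (f ⁻¹' {a}).indicator (fun _ => g a) x := by
    ext x
    rw [Finset.sum_eq_single_of_mem (f x) (f.mem_range_self x)]
    · simp
    · intro b _ hb
      exact Set.indicator_of_notMem (by simpa using hb.symm) _
  rw [h, integral_finsetSum _ fun a _ =>
    (integrable_const _).indicator (f.measurableSet_preimage _)]
  refine Finset.sum_congr rfl fun a _ => ?_
  rw [integral_indicator_const _ (f.measurableSet_preimage _), Complex.real_smul]

lemma sum_measureReal_simpleFunc (μ : Measure ℝ) [IsProbabilityMeasure μ] (f : SimpleFunc ℝ ℝ) :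
    ∑ a : f.range, μ.real (f ⁻¹' {a.1}) = 1 := by
  have := integral_comp_simpleFunc μ f (fun _ => 1)
  simp at this
  exact_mod_cast this.symm

lemma exists_cauchyG_eq_integral_simpleFunc (μ ν : Measure ℝ) [IsProbabilityMeasure μ]
    [IsProbabilityMeasure ν] (f g : SimpleFunc ℝ ℝ) :
    ∃ m : Measure ℝ, IsProbabilityMeasure m ∧ ∀ z ∈ UHP,
      cauchyG m z = ∫ x, ((∫ y, (z - (g y : ℂ))⁻¹ ∂ν)⁻¹ - (f x : ℂ))⁻¹ ∂μ := by
  choose k hk h using exists_cauchyG_eq_inv_sub (fun a : g.range => ν.real (g ⁻¹' {a.1}))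
    (fun a => a.1) (fun _ => measureReal_nonneg) (sum_measureReal_simpleFunc ν g)
  obtain ⟨m, hm, H⟩ := exists_cauchyG_eq_sum (fun a : f.range => μ.real (f ⁻¹' {a.1}))
    (fun _ => measureReal_nonneg) (sum_measureReal_simpleFunc μ f) (fun a => k a.1)
    (fun a => hk a.1)
  refine ⟨m, hm, fun z hz => ?_⟩
  rw [H z hz, integral_comp_simpleFunc μ f
    (fun b => ((∫ y, (z - (g y : ℂ))⁻¹ ∂ν)⁻¹ - (b : ℂ))⁻¹)]
  refine Finset.sum_congr rfl fun a _ => ?_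
  rw [h _ z hz, integral_comp_simpleFunc ν g (fun y => (z - (y : ℂ))⁻¹)]

/-- A tail bound in terms of the Cauchy transform on the imaginary axis. -/
lemma measureReal_lt_abs_le (μ : Measure ℝ) [IsProbabilityMeasure μ] {y : ℝ} (hy : 0 < y) :
    μ.real {x | y < ‖x‖} ≤ 2 * (1 - ((y * I) * cauchyG μ (y * I)).re) := by
  have hz : (y * I : ℂ) ∈ UHP := by simpa [UHP] using hy
  have hi := (integrable_inv_sub_ofReal μ hz).const_mul (y * I : ℂ)
  have hre : ((y * I) * cauchyG μ (y * I)).re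
      = ∫ x : ℝ, ((y * I : ℂ) * (y * I - (x : ℂ))⁻¹).re ∂μ := by
    rw [cauchyG, ← integral_const_mul]
    exact (integral_re (𝕜 := ℂ) hi).symm
  have hre' : ∀ x : ℝ, ((y * I : ℂ) * (y * I - (x : ℂ))⁻¹).re = y ^ 2 / (x ^ 2 + y ^ 2) := by
    intro x
    simp [Complex.mul_re, Complex.inv_im, Complex.normSq_apply]
    ring
  have hi' : Integrable (fun x : ℝ => 2 * (1 - y ^ 2 / (x ^ 2 + y ^ 2))) μ := by
    have := hi.re
    simp only [RCLike.re_to_complex, hre'] at this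
    exact ((integrable_const _).sub this).const_mul 2
  have hm : MeasurableSet {x : ℝ | y < ‖x‖} := measurableSet_lt measurable_const measurable_norm
  calc μ.real {x | y < ‖x‖} = ∫ x, {x : ℝ | y < ‖x‖}.indicator (fun _ => (1 : ℝ)) x ∂μ := by
        rw [integral_indicator_const _ hm]; simp
    _ ≤ ∫ x, 2 * (1 - y ^ 2 / (x ^ 2 + y ^ 2)) ∂μ := by
        refine integral_mono ((integrable_const _).indicator hm) hi' fun x => ?_
        have h0 : 0 < x ^ 2 + y ^ 2 := by positivity
        by_cases hx : y < ‖x‖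
        · rw [Set.indicator_of_mem (show x ∈ {x : ℝ | y < ‖x‖} from hx)]
          have h2 : y ^ 2 ≤ x ^ 2 := by
            rw [← sq_abs x]; exact pow_le_pow_left₀ hy.le (by simpa using hx.le) 2
          have h1 : y ^ 2 / (x ^ 2 + y ^ 2) ≤ 1 / 2 := by
            rw [div_le_iff₀ h0]; linarith
          linarith
        · rw [Set.indicator_of_notMem (show x ∉ {x : ℝ | y < ‖x‖} from hx)]
          have h1 : y ^ 2 / (x ^ 2 + y ^ 2) ≤ 1 := by
            rw [div_le_iff₀ h0]; nlinarith [sq_nonneg x]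
          linarith
    _ = _ := by
        have := hi.re
        simp only [RCLike.re_to_complex, hre'] at this
        rw [integral_const_mul, integral_sub (integrable_const _) this, hre]
        simp only [hre']
        simp

/-- A pointwise limit of Cauchy transforms of probability measures with the right decay along the
imaginary axis is the Cauchy transform of a probability measure. -/
lemma exists_cauchyG_eq_of_tendsto (m : ℕ → Measure ℝ) (hm : ∀ n, IsProbabilityMeasure (m n))
    (g : ℂ → ℂ) (hg : ∀ z ∈ UHP, Tendsto (fun n => cauchyG (m n) z) atTop (𝓝 (g z)))
    (hg1 : Tendsto (fun y : ℝ => (y * I : ℂ) * g (y * I)) atTop (𝓝 1)) :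
    ∃ μ : Measure ℝ, IsProbabilityMeasure μ ∧ ∀ z ∈ UHP, cauchyG μ z = g z := by
  have htight : IsTightMeasureSet (Set.range m) := by
    apply isTightMeasureSet_range_of_tendsto_limsup_measure_norm_gt
    have h0 : Tendsto (fun y : ℝ => ENNReal.ofReal (2 * (1 - ((y * I : ℂ) * g (y * I)).re))) atTop
        (𝓝 0) := by
      have h1 := (Complex.continuous_re.tendsto _).comp hg1
      have h2 := ENNReal.tendsto_ofReal ((h1.const_sub 1).const_mul 2)
      simpa using h2
    refine tendsto_of_tendsto_of_tendsto_of_le_of_le' tendsto_const_nhds h0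
      (.of_forall fun _ => zero_le) ?_
    filter_upwards [eventually_gt_atTop 0] with y hy
    have hz : (y * I : ℂ) ∈ UHP := by simpa [UHP] using hy
    have h1 := (Complex.continuous_re.tendsto _).comp ((hg _ hz).const_mul (y * I : ℂ))
    have h2 := ENNReal.tendsto_ofReal ((h1.const_sub 1).const_mul 2)
    rw [← h2.limsup_eq]
    refine limsup_le_limsup (.of_forall fun n => ?_)
    change m n _ ≤ _
    rw [← ofReal_measureReal]
    exact ENNReal.ofReal_le_ofReal (measureReal_lt_abs_le (m n) hy)
  let P : ℕ → ProbabilityMeasure ℝ := fun n => ⟨m n, hm n⟩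
  have hcomp : IsCompact (closure (Set.range P)) := by
    apply isCompact_closure_of_isTightMeasureSet
    refine htight.subset ?_
    rintro _ ⟨_, ⟨n, rfl⟩, rfl⟩
    exact ⟨n, rfl⟩
  obtain ⟨Q, -, φ, hφ, hQ⟩ := hcomp.tendsto_subseq fun n => subset_closure (Set.mem_range_self n)
  refine ⟨Q, inferInstance, fun z hz => ?_⟩
  let F : BoundedContinuousFunction ℝ ℂ := .ofNormedAddCommGroup (fun x : ℝ => (z - (x : ℂ))⁻¹)
    (continuous_inv_sub_ofReal hz) _ (norm_inv_sub_ofReal_le hz)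
  have h1 := (ProbabilityMeasure.tendsto_iff_forall_integral_rclike_tendsto ℂ).1 hQ F
  exact tendsto_nhds_unique h1 ((hg z hz).comp hφ.tendsto_atTop)

lemma tendsto_ofReal_mul_I_coneFilter {α : ℝ} (hα : 0 < α) :
    Tendsto (fun y : ℝ => (y * I : ℂ)) atTop (coneFilter α) := by
  refine tendsto_inf.2 ⟨tendsto_comap_iff.2 ?_, tendsto_principal.2 ?_⟩
  · have h : (Complex.im ∘ fun y : ℝ => (y * I : ℂ)) = id := by ext; simp
    rw [h]
    exact tendsto_id
  · filter_upwards [eventually_gt_atTop 0] with y hy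
    simpa using mul_pos hα hy

/-- Existence of the monotone convolution `μ ▷ ν`. -/
theorem exists_cauchyG_eq_comp (μ ν : Measure ℝ) [IsProbabilityMeasure μ]
    [IsProbabilityMeasure ν] :
    ∃ m : Measure ℝ, IsProbabilityMeasure m ∧ ∀ z ∈ UHP, cauchyG m z = cauchyG μ (Ftr ν z) := by
  let f : ℕ → SimpleFunc ℝ ℝ := fun n =>
    SimpleFunc.approxOn id measurable_id Set.univ 0 (Set.mem_univ _) n
  have hf : ∀ x, Tendsto (fun n => ((f n x : ℝ) : ℂ)) atTop (𝓝 x) := fun x =>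
    (Complex.continuous_ofReal.tendsto _).comp
      (SimpleFunc.tendsto_approxOn measurable_id _ (by simp))
  choose m hm h using fun n => exists_cauchyG_eq_integral_simpleFunc μ ν (f n) (f n)
  refine exists_cauchyG_eq_of_tendsto m hm _ (fun z hz => ?_) ?_
  · simp only [h _ z hz]
    have hG : Tendsto (fun n => ∫ y, (z - (f n y : ℂ))⁻¹ ∂ν) atTop (𝓝 (cauchyG ν z)) := by
      refine tendsto_integral_of_dominated_convergence (fun _ => z.im⁻¹) (fun n => ?_)
        (integrable_const _) (fun n => .of_forall fun y => norm_inv_sub_ofReal_le hz _)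
        (.of_forall fun y => ((hf y).const_sub z).inv₀ (sub_ofReal_ne_zero hz y))
      exact ((continuous_inv_sub_ofReal hz).measurable.comp (f n).measurable).aestronglyMeasurable
    have hF : Tendsto (fun n => (∫ y, (z - (f n y : ℂ))⁻¹ ∂ν)⁻¹) atTop (𝓝 (Ftr ν z)) :=
      hG.inv₀ (cauchyG_ne_zero ν hz)
    have hF0 : 0 < (Ftr ν z).im := Ftr_mem_UHP ν hz
    have hev := ((Complex.continuous_im.tendsto _).comp hF).eventually_const_lt
      (half_lt_self hF0)
    refine tendsto_integral_filter_of_dominated_convergence (fun _ => ((Ftr ν z).im / 2)⁻¹) ?_ ?_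
      (integrable_const _) (.of_forall fun x => ?_)
    · filter_upwards [hev] with n hn
      exact ((continuous_inv_sub_ofReal ((half_pos hF0).trans hn)).measurable.comp
        (f n).measurable).aestronglyMeasurable
    · filter_upwards [hev] with n hn
      exact .of_forall fun x => (norm_inv_sub_ofReal_le ((half_pos hF0).trans hn) _).trans
        (inv_anti₀ (half_pos hF0) hn.le)
    · exact (hF.sub (hf x)).inv₀ (sub_ofReal_ne_zero (Ftr_mem_UHP ν hz) x)
  · have h1 := (tendsto_mul_cauchyG ν 1).comp (tendsto_ofReal_mul_I_coneFilter one_pos)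
    have h2 := (tendsto_mul_cauchyG μ 2).comp (((asympId_Ftr ν).tendsto one_pos one_lt_two).comp
      (tendsto_ofReal_mul_I_coneFilter one_pos))
    have h3 := h1.mul h2
    rw [one_mul] at h3
    refine h3.congr' ?_
    filter_upwards [eventually_gt_atTop 0] with y hy
    have hz : (y * I : ℂ) ∈ UHP := by simpa [UHP] using hy
    have := cauchyG_ne_zero ν hz
    simp only [Function.comp_apply, Ftr]
    field_simp

/-- If `F_σ(z) = F_τ(z')`, with `τ = ω ⊳ ρ` the subordination distribution, then the defining
equations of the Voiculescu transforms at `z` and `z'` combine to that of `ρ ▷ σ` at `z`. -/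
lemma isVT_of_subordination {ρ κ τ σ m : Measure ℝ} [IsProbabilityMeasure τ]
    [IsProbabilityMeasure σ] {φω φρ φτ : ℂ → ℂ} {s : ℝ} (hρ : IsVT ρ φρ)
    (hκ : IsVT κ fun z => φω z + φρ z) (hsub : ∀ z ∈ UHP, cauchyG κ z = cauchyG ρ (Ftr τ z))
    (hτ : IsVT τ φτ) (hσ : IsVT σ fun z => (s : ℂ) * φτ z)
    (hm : ∀ z ∈ UHP, Ftr m z = Ftr ρ (Ftr σ z)) :
    IsVT m fun z => φρ z + (s : ℂ) * φω z := by
  rw [isVT_iff] at *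
  obtain ⟨α₁, h₁, H₁⟩ := hρ
  obtain ⟨α₂, h₂, H₂⟩ := hκ
  obtain ⟨α₃, h₃, H₃⟩ := hτ
  obtain ⟨α₄, h₄, H₄⟩ := hσ
  obtain ⟨β, hβ, hβ₁, hβ₂, hβ₃⟩ : ∃ β : ℝ, 0 < β ∧ β < α₁ ∧ β ≤ α₂ ∧ β ≤ α₃ :=
    ⟨min (α₁ / 2) (min α₂ α₃), by positivity, (min_le_left _ _).trans_lt (by linarith),
      (min_le_right _ _).trans (min_le_left _ _), (min_le_right _ _).trans (min_le_right _ _)⟩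
  obtain ⟨α, hα, hαβ, hα₄⟩ : ∃ α : ℝ, 0 < α ∧ α < β / 2 ∧ α ≤ α₄ :=
    ⟨min (β / 3) α₄, by positivity, (min_le_left _ _).trans_lt (by linarith), min_le_right _ _⟩
  have hgood := (((asympId_Ftr τ).tendsto hβ hβ₁).eventually H₁).and
    ((H₂.filter_mono (coneFilter_mono hβ₂)).and
      ((H₃.filter_mono (coneFilter_mono hβ₃)).and (eventually_lt_im_coneFilter β 0)))
  have hpre := (asympId_Ftr τ).eventually_exists_eq (differentiableOn_Ftr τ) (half_pos hβ)
    (half_lt_self hβ) hgood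
  refine ⟨α, hα, ?_⟩
  filter_upwards [((asympId_Ftr σ).tendsto hα hαβ).eventually hpre,
    H₄.filter_mono (coneFilter_mono hα₄), eventually_lt_im_coneFilter α 0]
    with z ⟨z', ⟨e₁, e₂, e₃, hz'⟩, e⟩ e₄ hz
  have hκF : Ftr κ z' = Ftr ρ (Ftr τ z') := congrArg (·⁻¹) (hsub z' hz')
  rw [hκF] at e₂
  rw [e] at e₁ e₂ e₃
  rw [hm z hz]
  linear_combination e₁ + e₄ + (s : ℂ) * (e₂ - e₁ - e₃)

end

/-- Let `p > 0` and let `ω, tρ` be probability measures whose subordination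
distribution `sub = ω ⊳ tρ` is ⊞-infinitely divisible (with powers `subpow s = sub^{⊞s}`).
Then for every `t ≥ 0` the function `φ_{tρ} + (t/p)·φ_ω` is the Voiculescu transform of a
probability measure, namely of the monotone convolution `tρ ▷ (ω ⊳ tρ)^{⊞(t/p)}`;
in particular `tρ ⊞ ω^{⊞(t/p)}` is a well-defined probability measure for all `t ≥ 0`. -/
theorem stmt6
    (p : ℝ) (hp : 0 < p)
    (ω tρ : Measure ℝ) (hω : IsProbabilityMeasure ω) (htρ : IsProbabilityMeasure tρ)
    (φω φρ : ℂ → ℂ) (hφω : IsVT ω φω) (hφρ : IsVT tρ φρ)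
    (conv : Measure ℝ) (hconvprob : IsProbabilityMeasure conv)
    (hconv : IsVT conv (fun z => φω z + φρ z))
    (sub : Measure ℝ) (hsubprob : IsProbabilityMeasure sub)
    (hsubdef : ∀ z ∈ UHP, cauchyG conv z = cauchyG tρ (Ftr sub z))
    (φs : ℂ → ℂ) (hφs : IsVT sub φs)
    (subpow : ℝ → Measure ℝ) (hsp : ∀ s : ℝ, 0 ≤ s → IsProbabilityMeasure (subpow s))
    (hspVT : ∀ s : ℝ, 0 ≤ s → IsVT (subpow s) (fun z => (s : ℂ) * φs z)) :
    ∀ t : ℝ, 0 ≤ t → ∃ m : Measure ℝ, IsProbabilityMeasure m ∧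
      (∀ z ∈ UHP, Ftr m z = Ftr tρ (Ftr (subpow (t / p)) z)) ∧
      IsVT m (fun z => φρ z + ((t / p : ℝ) : ℂ) * φω z) := by
  intro t ht
  have hs : 0 ≤ t / p := by positivity
  have := hsp _ hs
  obtain ⟨m, hm, h⟩ := exists_cauchyG_eq_comp tρ (subpow (t / p))
  have hF : ∀ z ∈ UHP, Ftr m z = Ftr tρ (Ftr (subpow (t / p)) z) :=
    fun z hz => congrArg (·⁻¹) (h z hz)
  exact ⟨m, hm, hF, isVT_of_subordination hφρ hconv hsubdef hφs (hspVT _ hs) hF⟩
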